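/- Let G₀ be the graph with vertex set {x, y, u₁, u₂, u₃, u₄, u₅, v₁, v₂, v₃, v₄, v₅} and edge set {u₁u₂, u₂u₃, u₃u₄, u₄u₅, u₅u₁} ∪ {v₁v₂, v₂v₃, v₃v₄, v₄v₅, v₅v₁} ∪ {xu₁, xu₃, xv₁, xv₃} ∪ {yu₂, yu₄, yv₂, yv₄} ∪ {u₅v₅}. Then x and y are non-adjacent in G₀, and in every proper 3-colouring c : V(G₀) → {1,2,3} of G₀ the vertices x and y receive different colours, i.e. c(x) ≠ c(y). -/

import Mathlib

open SimpleGraph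

/-- The edges of the gadget graph `G₀`, with the labelling
`x = 0`, `y = 1`, `uᵢ = 1 + i` (so `u₁,…,u₅ = 2,…,6`) and `vᵢ = 6 + i`
(so `v₁,…,v₅ = 7,…,11`): the two 5-cycles `u₁u₂u₃u₄u₅` and `v₁v₂v₃v₄v₅`,
the edges `xu₁, xu₃, xv₁, xv₃`, the edges `yu₂, yu₄, yv₂, yv₄`, and the
edge `u₅v₅`. -/
def gadgetEdges : List (Fin 12 × Fin 12) :=
  [(2, 3), (3, 4), (4, 5), (5, 6), (6, 2),
   (7, 8), (8, 9), (9, 10), (10, 11), (11, 7),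
   (0, 2), (0, 4), (0, 7), (0, 9),
   (1, 3), (1, 5), (1, 8), (1, 10),
   (6, 11)]

/-- The gadget graph `G₀` on 12 vertices and 19 edges. -/
def gadget : SimpleGraph (Fin 12) :=
  SimpleGraph.fromRel (fun a b => (a, b) ∈ gadgetEdges)

/-- If the vertices `p₁, p₂, p₃, p₄` of a properly 3-coloured 5-cycle all avoid the colour `a`,
then the fifth vertex has colour `a`. -/
theorem fifth_eq_of_five_cycle {a p₁ p₂ p₃ p₄ p₅ : Fin 3}
    (h₁₂ : p₁ ≠ p₂) (h₂₃ : p₂ ≠ p₃) (h₃₄ : p₃ ≠ p₄) (h₄₅ : p₄ ≠ p₅) (h₅₁ : p₅ ≠ p₁)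
    (h₁ : a ≠ p₁) (h₂ : a ≠ p₂) (h₃ : a ≠ p₃) (h₄ : a ≠ p₄) : p₅ = a := by
  omega

/-- The key property of the gadget `G₀`: the vertices `x = 0` and `y = 1` are
non-adjacent, and in every proper 3-colouring of `G₀` they receive different
colours. -/
theorem gadget_forces_distinct_colours :
    ¬ gadget.Adj 0 1 ∧
    ∀ c : Fin 12 → Fin 3, (∀ a b, gadget.Adj a b → c a ≠ c b) → c 0 ≠ c 1 := by
  refine ⟨by simp [gadget, gadgetEdges], fun c hc hxy => ?_⟩
  have h : ∀ e ∈ gadgetEdges, c e.1 ≠ c e.2 := fun e he =>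
    hc e.1 e.2 <| (fromRel_adj _ _ _).2
      ⟨by revert e; simp [gadgetEdges], Or.inl he⟩
  simp only [gadgetEdges, List.forall_mem_cons] at h
  obtain ⟨u₁₂, u₂₃, u₃₄, u₄₅, u₅₁, v₁₂, v₂₃, v₃₄, v₄₅, v₅₁,
    xu₁, xu₃, xv₁, xv₃, yu₂, yu₄, yv₂, yv₄, uv, -⟩ := h
  rw [← hxy] at yu₂ yu₄ yv₂ yv₄
  exact uv <| (fifth_eq_of_five_cycle u₁₂ u₂₃ u₃₄ u₄₅ u₅₁ xu₁ yu₂ xu₃ yu₄).trans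
    (fifth_eq_of_five_cycle v₁₂ v₂₃ v₃₄ v₄₅ v₅₁ xv₁ yv₂ xv₃ yv₄).symm
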